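/- Define φ : ℂ → ℂ by φ(0) = 0 and φ(z) = (exp(-1/‖z‖)/‖z‖) · z for z ≠ 0; this is the chart map of the exotic complex structure CS₁ on the plane from Brans' toy model. Then there is no homeomorphism F : ℂ → ℂ (continuous bijection with continuous inverse) such that the composite φ ∘ F is complex differentiable at every point of ℂ. -/

import Mathlib

/-- The chart `z ↦ (exp(-1/‖z‖)/‖z‖) • z` takes values in the closed unit disc. -/
lemma norm_exp_neg_inv_norm_chart_le_one (z : ℂ) :
    ‖if z = 0 then 0 else ((Real.exp (-1 / ‖z‖) / ‖z‖ : ℝ) : ℂ) * z‖ ≤ 1 := by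
  split_ifs with h
  · simp
  · have hz : ‖z‖ ≠ 0 := norm_ne_zero_iff.mpr h
    rw [norm_mul, Complex.norm_real, Real.norm_of_nonneg (by positivity), div_mul_cancel₀ _ hz,
      Real.exp_le_one_iff]
    exact div_nonpos_of_nonpos_of_nonneg (by norm_num) (norm_nonneg z)

/-- The exotic complex structure `CS₁` defined by the global chart
`φ z = (exp(-1/‖z‖)/‖z‖) • z` (with `φ 0 = 0`) is not analytically equivalent
to the standard structure: there is no homeomorphism `F : ℂ → ℂ` such that
`φ ∘ F` is entire. -/
theorem exotic_structure_inequivalent :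
    ¬ ∃ F : ℂ ≃ₜ ℂ, ∀ z : ℂ, DifferentiableAt ℂ
      (fun w : ℂ =>
        if F w = 0 then 0 else ((Real.exp (-1 / ‖F w‖) / ‖F w‖ : ℝ) : ℂ) * F w) z := by
  rintro ⟨F, hF⟩
  have hconst := Differentiable.apply_eq_apply_of_bounded hF
    (isBounded_iff_forall_norm_le.mpr ⟨1, by
      rintro _ ⟨w, rfl⟩
      exact norm_exp_neg_inv_norm_chart_le_one (F w)⟩) (F.symm 1) (F.symm 0)
  simp [Complex.exp_ne_zero] at hconst
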